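/- Suppose p > 1, w ∈ A_p on ℝⁿ, and set ε = c·[w]_{A_p}^{1-p'} for a suitable small dimensional constant c > 0. Then ε < p - 1, w ∈ A_{p-ε}, and [w]_{A_{p-ε}} ≤ C(n,p)·[w]_{A_p}. -/

import Mathlib

open MeasureTheory ENNReal Set
noncomputable section

abbrev Rn (n : ℕ) := Fin n → ℝ

/-- Axis-parallel cube with center `c` and half-sidelength `r`. -/
def cube (n : ℕ) (c : Rn n) (r : ℝ) : Set (Rn n) := {y | ∀ i, |y i - c i| ≤ r}

/-- Hardy–Littlewood maximal operator over cubes (ℝ≥0∞-valued input). -/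
def Mop (n : ℕ) (f : Rn n → ℝ≥0∞) (x : Rn n) : ℝ≥0∞ :=
  ⨆ (c : Rn n) (r : ℝ) (_ : 0 < r) (_ : x ∈ cube n c r),
    (volume (cube n c r))⁻¹ * ∫⁻ y in cube n c r, f y

/-- Hardy–Littlewood maximal operator of a real function. -/
def MopR (n : ℕ) (f : Rn n → ℝ) (x : Rn n) : ℝ≥0∞ :=
  Mop n (fun y => ENNReal.ofReal |f y|) x

/-- Muckenhoupt `A_p` constant. -/
def ApConst (n : ℕ) (p : ℝ) (w : Rn n → ℝ) : ℝ≥0∞ :=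
  ⨆ (c : Rn n) (r : ℝ) (_ : 0 < r),
    ((volume (cube n c r))⁻¹ * ∫⁻ y in cube n c r, ENNReal.ofReal (w y)) *
      ((volume (cube n c r))⁻¹ *
        ∫⁻ y in cube n c r, (ENNReal.ofReal (w y)) ^ (-(1 / (p - 1)))) ^ (p - 1)

/-- Muckenhoupt `A_1` constant. -/
def A1Const (n : ℕ) (w : Rn n → ℝ) : ℝ≥0∞ :=
  ⨆ (c : Rn n) (r : ℝ) (_ : 0 < r),
    ((volume (cube n c r))⁻¹ * ∫⁻ y in cube n c r, ENNReal.ofReal (w y)) *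
      (essInf (fun y => ENNReal.ofReal (w y)) (volume.restrict (cube n c r)))⁻¹

/-- Fujii–Wilson `A_∞` constant. -/
def AinfConst (n : ℕ) (w : Rn n → ℝ) : ℝ≥0∞ :=
  ⨆ (c : Rn n) (r : ℝ) (_ : 0 < r),
    (∫⁻ y in cube n c r, ENNReal.ofReal (w y))⁻¹ *
      ∫⁻ x in cube n c r, Mop n ((cube n c r).indicator (fun y => ENNReal.ofReal (w y))) x

/-- Young function predicate. -/
def IsYoung (Φ : ℝ → ℝ) : Prop :=
  ContinuousOn Φ (Ici 0) ∧ ConvexOn ℝ (Ici 0) Φ ∧ MonotoneOn Φ (Ici 0) ∧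
    Φ 0 = 0 ∧ Filter.Tendsto Φ Filter.atTop Filter.atTop

/-- Mean Luxemburg norm of `f` on `Q`. -/
def luxNorm {n : ℕ} (Φ : ℝ → ℝ) (f : Rn n → ℝ) (Q : Set (Rn n)) : ℝ :=
  sInf {l : ℝ | 0 < l ∧
    (volume Q)⁻¹ * (∫⁻ x in Q, ENNReal.ofReal (Φ (|f x| / l))) ≤ 1}

/-- Weighted mean Luxemburg norm of `f` on `Q`. -/
def wLuxNorm {n : ℕ} (Φ : ℝ → ℝ) (w f : Rn n → ℝ) (Q : Set (Rn n)) : ℝ :=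
  sInf {l : ℝ | 0 < l ∧
    (∫⁻ x in Q, ENNReal.ofReal (w x))⁻¹ *
      (∫⁻ x in Q, ENNReal.ofReal (Φ (|f x| / l)) * ENNReal.ofReal (w x)) ≤ 1}

/-- Orlicz maximal function `M_Φ`. -/
def MOrlicz (n : ℕ) (Φ : ℝ → ℝ) (f : Rn n → ℝ) (x : Rn n) : ℝ≥0∞ :=
  ⨆ (c : Rn n) (r : ℝ) (_ : 0 < r) (_ : x ∈ cube n c r),
    ENNReal.ofReal (luxNorm Φ f (cube n c r))

/-- `B_p` constant of a Young function, ℝ≥0∞-valued. -/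
def BpConst (Φ : ℝ → ℝ) (p : ℝ) : ℝ≥0∞ :=
  (∫⁻ t in Ioi (1 : ℝ), ENNReal.ofReal (Φ t / t ^ (p + 1))) ^ (1 / p)

/-- `B_p` constant of a Young function, real-valued. -/
def BpConstR (Φ : ℝ → ℝ) (p : ℝ) : ℝ :=
  (∫ t in Ioi (1 : ℝ), Φ t / t ^ (p + 1)) ^ (1 / p)

/-- Weighted `L^p` "norm" of an ℝ≥0∞-valued function. -/
def wLp (n : ℕ) (p : ℝ) (f : Rn n → ℝ≥0∞) (w : Rn n → ℝ) : ℝ≥0∞ :=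
  (∫⁻ x, (f x) ^ p * ENNReal.ofReal (w x)) ^ (1 / p)

/-- Sparse family of sets. -/
def IsSparse (n : ℕ) (S : Set (Set (Rn n))) : Prop :=
  ∃ E : Set (Rn n) → Set (Rn n),
    (∀ Q ∈ S, E Q ⊆ Q ∧ MeasurableSet (E Q) ∧ volume Q ≤ 2 * volume (E Q)) ∧
    S.PairwiseDisjoint E

/-- Non-increasing rearrangement of `g` restricted to `Q`, evaluated at `t`. -/
def rearr {n : ℕ} (g : Rn n → ℝ) (Q : Set (Rn n)) (t : ℝ≥0∞) : ℝ :=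
  sInf {s : ℝ | 0 ≤ s ∧ volume {x ∈ Q | s < |g x|} ≤ t}

/-- Local mean oscillation `ω_λ(f;Q)`. -/
def osc {n : ℕ} (lam : ℝ) (f : Rn n → ℝ) (Q : Set (Rn n)) : ℝ :=
  ⨅ c : ℝ, rearr (fun x => f x - c) Q (ENNReal.ofReal lam * volume Q)

/-- The dyadic lattice generated by the cube with center `c`, half-side `r`. -/
def dyadicSub (n : ℕ) (c : Rn n) (r : ℝ) : Set (Set (Rn n)) :=
  {Q | ∃ (k : ℕ) (j : Fin n → ℕ), (∀ i, j i < 2 ^ k) ∧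
    Q = cube n (fun i => c i - r + (2 * (j i : ℝ) + 1) * (r / 2 ^ k)) (r / 2 ^ k)}

/-- `m` is a median value of `f` on `Q`. -/
def IsMedian {n : ℕ} (f : Rn n → ℝ) (Q : Set (Rn n)) (m : ℝ) : Prop :=
  volume {x ∈ Q | m < f x} ≤ volume Q / 2 ∧ volume {x ∈ Q | f x < m} ≤ volume Q / 2


/-- half-open cube with lower corner and side -/
def hq (n : ℕ) (l : Rn n) (s : ℝ) : Set (Rn n) := Set.pi univ (fun i => Ico (l i) (l i + s))

def chd {n : ℕ} (l : Rn n) (s : ℝ) (e : Fin n → Bool) : Rn n :=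
  fun i => if e i then l i + s / 2 else l i

lemma hq_meas {n : ℕ} (l : Rn n) (s : ℝ) : MeasurableSet (hq n l s) :=
  MeasurableSet.univ_pi (fun _ => measurableSet_Ico)

lemma hq_vol {n : ℕ} (l : Rn n) {s : ℝ} (hs : 0 < s) :
    volume (hq n l s) = ENNReal.ofReal (s ^ n) := by
  rw [hq, Real.volume_pi_Ico]
  simp [ENNReal.ofReal_pow hs.le]

lemma hq_volr {n : ℕ} (l : Rn n) {s : ℝ} (hs : 0 < s) :
    volume.real (hq n l s) = s ^ n := by
  rw [Measure.real, hq_vol l hs, ENNReal.toReal_ofReal (by positivity)]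

lemma hq_split {n : ℕ} (l : Rn n) {s : ℝ} (hs : 0 < s) :
    hq n l s = ⋃ e : Fin n → Bool, hq n (chd l s e) (s / 2) := by
  ext x
  simp only [hq, mem_iUnion, Set.mem_pi, mem_univ, true_implies, mem_Ico, chd]
  constructor
  · intro h
    refine ⟨fun i => decide (l i + s / 2 ≤ x i), fun i => ?_⟩
    have := h i
    by_cases hx : l i + s / 2 ≤ x i
    · simp only [hx, decide_true, if_true]; exact ⟨trivial, by linarith [this.2]⟩
    · simp only [hx, decide_false]; push Not at hx; constructor <;> simp <;> linarith
  · rintro ⟨e, h⟩ i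
    have := h i
    split_ifs at this <;> constructor <;> linarith

lemma hq_disj {n : ℕ} (l : Rn n) (s : ℝ) :
    Pairwise (Function.onFun Disjoint (fun e : Fin n → Bool => hq n (chd l s e) (s / 2))) := by
  intro e e' hne
  rw [Function.onFun, Set.disjoint_left]
  intro x hx hx'
  apply hne
  funext i
  have h1 := hx i (mem_univ _)
  have h2 := hx' i (mem_univ _)
  simp only [chd, mem_Ico] at h1 h2
  cases h : e i <;> cases h' : e' i <;> simp_all <;> linarith

lemma hq_child_sub {n : ℕ} (l : Rn n) {s : ℝ} (hs : 0 < s) (e : Fin n → Bool) :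
    hq n (chd l s e) (s / 2) ⊆ hq n l s := by
  rw [hq_split l hs]; exact subset_iUnion (fun e => hq n (chd l s e) (s / 2)) e

/-- average -/
def av {n : ℕ} (m : Measure (Rn n)) (l : Rn n) (s : ℝ) : ℝ := m.real (hq n l s) / s ^ n

def SS {n : ℕ} (m : Measure (Rn n)) (d : ℝ) : ℕ → Rn n → ℝ → ℝ
  | 0, l, s => av m l s ^ d * m.real (hq n l s)
  | (N+1), l, s => ∑ e : Fin n → Bool, SS m d N (chd l s e) (s / 2)

open Classical in
def EE {n : ℕ} (m : Measure (Rn n)) (t : ℝ) : ℕ → Rn n → ℝ → Set (Rn n)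
  | 0, l, s => if t < av m l s then ∅ else hq n l s
  | (N+1), l, s => if t < av m l s then ∅ else ⋃ e : Fin n → Bool, EE m t N (chd l s e) (s / 2)

lemma EE_meas {n : ℕ} (m : Measure (Rn n)) (t : ℝ) (N : ℕ) :
    ∀ l s, MeasurableSet (EE m t N l s) := by
  induction N with
  | zero => intro l s; rw [EE]; split_ifs <;> simp [hq_meas]
  | succ N ih =>
    intro l s; rw [EE]; split_ifs
    · simp
    · exact MeasurableSet.iUnion (fun e => ih _ _)

lemma EE_sub {n : ℕ} (m : Measure (Rn n)) (t : ℝ) (N : ℕ) :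
    ∀ l s, 0 < s → EE m t N l s ⊆ hq n l s := by
  induction N with
  | zero => intro l s hs; rw [EE]; split_ifs <;> simp
  | succ N ih =>
    intro l s hs; rw [EE]; split_ifs
    · simp
    · exact iUnion_subset (fun e => (ih _ _ (by positivity)).trans (hq_child_sub l hs e))

lemma real_sum {n : ℕ} (m : Measure (Rn n)) (l : Rn n) {s : ℝ}
    (hfin : m (hq n l s) ≠ ∞) (hs : 0 < s)
    (E : (Fin n → Bool) → Set (Rn n)) (hE : ∀ e, MeasurableSet (E e))
    (hsub : ∀ e, E e ⊆ hq n (chd l s e) (s / 2)) :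
    m.real (⋃ e, E e) = ∑ e, m.real (E e) := by
  have hd : Pairwise (Function.onFun Disjoint E) := fun e e' hne =>
    (hq_disj l s hne).mono (hsub e) (hsub e')
  rw [Measure.real, measure_iUnion hd hE, tsum_fintype, ENNReal.toReal_sum]
  · rfl
  · intro e _
    exact ne_top_of_le_ne_top hfin (measure_mono ((hsub e).trans (hq_child_sub l hs e)))

lemma hq_real_sum {n : ℕ} (m : Measure (Rn n)) (l : Rn n) {s : ℝ}
    (hfin : m (hq n l s) ≠ ∞) (hs : 0 < s) :
    m.real (hq n l s) = ∑ e : Fin n → Bool, m.real (hq n (chd l s e) (s / 2)) := by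
  conv_lhs => rw [hq_split l hs]
  exact real_sum m l hfin hs _ (fun e => hq_meas _ _) (fun e => subset_rfl)

lemma av_child {n : ℕ} (m : Measure (Rn n)) (l : Rn n) {s : ℝ}
    (hfin : m (hq n l s) ≠ ∞) (hs : 0 < s) (e : Fin n → Bool) :
    av m (chd l s e) (s / 2) ≤ 2 ^ n * av m l s := by
  have : m.real (hq n (chd l s e) (s / 2)) ≤ m.real (hq n l s) :=
    measureReal_mono (hq_child_sub l hs e) hfin
  rw [av, av, div_pow, div_div_eq_mul_div, ← mul_div_assoc, mul_comm]
  gcongr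

lemma EE_vol {n : ℕ} (m : Measure (Rn n)) (hfin : ∀ l s, m (hq n l s) ≠ ∞) {t : ℝ} (ht : 0 < t)
    (N : ℕ) :
    ∀ l s, 0 < s → s ^ n - volume.real (EE m t N l s) ≤ m.real (hq n l s) / t := by
  induction N with
  | zero =>
    intro l s hs; rw [EE]; split_ifs with h
    · rw [av, lt_div_iff₀ (by positivity)] at h
      rw [le_div_iff₀ ht]; simp; linarith
    · rw [hq_volr l hs]; simp; positivity
  | succ N ih =>
    intro l s hs; rw [EE]; split_ifs with h
    · rw [av, lt_div_iff₀ (by positivity)] at h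
      rw [le_div_iff₀ ht]; simp; linarith
    · have hv : volume (hq n l s) ≠ ∞ := by rw [hq_vol l hs]; simp
      rw [real_sum volume l hv hs _ (fun e => EE_meas m t N _ _)
        (fun e => EE_sub m t N _ _ (by positivity)), ← hq_volr l hs, hq_real_sum volume l hv hs,
        hq_real_sum m l (hfin _ _) hs, ← Finset.sum_sub_distrib, Finset.sum_div]
      refine Finset.sum_le_sum (fun e _ => ?_)
      rw [hq_volr _ (by positivity : 0 < s / 2)]
      exact ih _ _ (by positivity)

lemma SS_stop {n : ℕ} (m : Measure (Rn n)) (hfin : ∀ l s, m (hq n l s) ≠ ∞) {t d X : ℝ}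
    (ht : 0 < t) (hd : 0 ≤ d) (hX : 0 ≤ X) (N : ℕ)
    (k : ℕ) (hkN : k ≤ N)
    (hyp : ∀ j, j < N → ∀ l s, 0 < s → SS m d j l s ≤ X * av m l s ^ d * m.real (hq n l s)) :
    ∀ l s, 0 < s → av m l s ≤ 2 ^ n * t → (k < N ∨ av m l s ≤ t) →
      SS m d k l s ≤ t ^ d * m.real (EE m t k l s)
        + X * (2 ^ n * t) ^ d * (m.real (hq n l s) - m.real (EE m t k l s)) := by
  have key : ∀ k l s, 0 < s → av m l s ≤ 2 ^ n * t → k < N →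
      SS m d k l s ≤ X * (2 ^ n * t) ^ d * m.real (hq n l s) := by
    intro k l s hs ha hk
    refine (hyp k hk l s hs).trans ?_
    have : 0 ≤ av m l s := by unfold av; positivity
    gcongr
  induction k with
  | zero =>
    intro l s hs ha hor
    rw [EE]; split_ifs with h
    · have hk : 0 < N := by rcases hor with h' | h'; exacts [h', absurd h (not_lt.2 h')]
      simpa using key 0 l s hs ha hk
    · rw [SS, sub_self, mul_zero, add_zero]
      have : 0 ≤ av m l s := by unfold av; positivity
      push Not at h
      gcongr
  | succ k ih =>
    intro l s hs ha hor
    rw [EE]; split_ifs with h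
    · have hk : k + 1 < N := by rcases hor with h' | h'; exacts [h', absurd h (not_lt.2 h')]
      simpa using key (k+1) l s hs ha hk
    · push Not at h
      rw [SS, real_sum m l (hfin _ _) hs _ (fun e => EE_meas m t k _ _)
        (fun e => EE_sub m t k _ _ (by positivity)), hq_real_sum m l (hfin _ _) hs,
        ← Finset.sum_sub_distrib, Finset.mul_sum, Finset.mul_sum, ← Finset.sum_add_distrib]
      refine Finset.sum_le_sum (fun e _ => ?_)
      refine ih (by omega) _ _ (by positivity) ?_ (Or.inl (by omega))
      refine (av_child m l (hfin _ _) hs e).trans ?_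
      gcongr

lemma SS_main {n : ℕ} (m : Measure (Rn n)) (hfin : ∀ l s, m (hq n l s) ≠ ∞)
    (hpos : ∀ l s, 0 < s → 0 < m.real (hq n l s)) {d η : ℝ}
    (hd : 0 ≤ d) (hη : 0 < η) (hη1 : η ≤ 1)
    (hdη : (2 : ℝ) ^ ((n + 1) * d) ≤ 1 + η / 2)
    (H : ∀ l s, 0 < s → ∀ E, MeasurableSet E → E ⊆ hq n l s → s ^ n / 2 ≤ volume.real E →
      η * m.real (hq n l s) ≤ m.real E) (N : ℕ) :
    ∀ l s, 0 < s → SS m d N l s ≤ (2 * 2 ^ d) * av m l s ^ d * m.real (hq n l s) := by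
  have h2d : (1 : ℝ) ≤ 2 ^ d := Real.one_le_rpow (by norm_num) hd
  induction N using Nat.strong_induction_on with
  | _ N IH =>
    intro l s hs
    have hM := hpos l s hs
    have hA : 0 < av m l s := by unfold av; positivity
    have h1 := SS_stop m hfin (t := 2 * av m l s) (by positivity) hd
      (by positivity : (0:ℝ) ≤ 2 * 2 ^ d) N N le_rfl IH l s hs
      (by
        have : (1:ℝ) ≤ 2 ^ n := one_le_pow₀ (by norm_num)
        nlinarith)
      (Or.inr (by linarith))
    have h2 := EE_vol m hfin (t := 2 * av m l s) (by positivity) N l s hs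
    have h3 : m.real (hq n l s) / (2 * av m l s) = s ^ n / 2 := by
      unfold av; field_simp
    have h4 := H l s hs _ (EE_meas m (2 * av m l s) N l s) (EE_sub m _ N l s hs) (by linarith)
    set g := m.real (EE m (2 * av m l s) N l s)
    set M := m.real (hq n l s)
    set A := av m l s
    have h5 : (2 ^ n * (2 * A)) ^ d = 2 ^ ((n + 1) * d) * A ^ d := by
      rw [← mul_assoc, Real.mul_rpow (by positivity) hA.le, Real.rpow_mul (by norm_num)]
      congr 2
      norm_cast
    rw [h5, Real.mul_rpow (by norm_num) hA.le] at h1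
    refine h1.trans ?_
    set B := (2 : ℝ) ^ ((n + 1) * d)
    have hB : 1 ≤ B := Real.one_le_rpow (by norm_num) (by positivity)
    have hAd : 0 < A ^ d := by positivity
    have e1 : g + 2 * B * (M - g) ≤ 2 * M := by
      have : (2 * B - 1) * (η * M) ≤ (2 * B - 1) * g := by gcongr; linarith
      have e3 : η * M + 2 * B * (M - η * M) ≤ 2 * M := by
        have : 2 * B * (M - η * M) ≤ 2 * (1 + η / 2) * (M - η * M) := by
          have : 0 ≤ M - η * M := by nlinarith
          gcongr
        nlinarith [sq_nonneg η]
      nlinarith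
    calc 2 ^ d * A ^ d * g + 2 * 2 ^ d * (B * A ^ d) * (M - g)
        = 2 ^ d * A ^ d * (g + 2 * B * (M - g)) := by ring
      _ ≤ 2 ^ d * A ^ d * (2 * M) := by gcongr
      _ = _ := by ring

lemma cube_eq {n : ℕ} (c : Rn n) {r : ℝ} (hr : 0 ≤ r) : cube n c r = Metric.closedBall c r := by
  ext y
  simp [cube, Metric.mem_closedBall, dist_pi_le_iff hr, Real.dist_eq]

lemma hq_ae {n : ℕ} (l : Rn n) {s : ℝ} (hs : 0 < s) :
    hq n l s =ᵐ[volume] Metric.closedBall (fun i => l i + s / 2) (s / 2) := by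
  have : Metric.closedBall (fun i => l i + s / 2) (s / 2) = Icc l (fun i => l i + s) := by
    ext y
    simp only [Metric.mem_closedBall, dist_pi_le_iff (by positivity : 0 ≤ s / 2), Real.dist_eq,
      mem_Icc, Pi.le_def, abs_le, ← forall_and]
    refine forall_congr' (fun i => ?_)
    constructor <;> rintro ⟨h1, h2⟩ <;> constructor <;> linarith
  rw [this]
  exact Measure.univ_pi_Ico_ae_eq_Icc (μ := fun _ : Fin n => (volume : Measure ℝ))

lemma cube_ae {n : ℕ} (c : Rn n) {r : ℝ} (hr : 0 < r) :
    cube n c r =ᵐ[volume] hq n (fun i => c i - r) (2 * r) := by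
  have := hq_ae (fun i => c i - r) (by positivity : 0 < 2 * r)
  rw [cube_eq c hr.le]
  simpa using this.symm

lemma av_nonneg {n : ℕ} (m : Measure (Rn n)) (l : Rn n) {s : ℝ} (hs : 0 < s) : 0 ≤ av m l s := by
  unfold av; positivity

lemma ofReal_av {n : ℕ} (m : Measure (Rn n)) (l : Rn n) {s : ℝ} (hs : 0 < s)
    (hfin : m (hq n l s) ≠ ∞) :
    ENNReal.ofReal (av m l s) = m (hq n l s) / volume (hq n l s) := by
  rw [av, ENNReal.ofReal_div_of_pos (by positivity), hq_vol l hs, Measure.real,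
    ENNReal.ofReal_toReal hfin]

def gg {n : ℕ} (m : Measure (Rn n)) : ℕ → Rn n → ℝ → Rn n → ℝ≥0∞
  | 0, l, s => fun _ => ENNReal.ofReal (av m l s)
  | (N+1), l, s => fun x => ∑ e : Fin n → Bool,
      (hq n (chd l s e) (s / 2)).indicator (gg m N (chd l s e) (s / 2)) x

lemma gg_meas {n : ℕ} (m : Measure (Rn n)) (N : ℕ) : ∀ l s, Measurable (gg m N l s) := by
  induction N with
  | zero => intro l s; unfold gg; exact measurable_const
  | succ N ih =>
    intro l s; unfold gg
    exact Finset.measurable_sum _ (fun e _ => (ih _ _).indicator (hq_meas _ _))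

lemma gg_child {n : ℕ} (m : Measure (Rn n)) (N : ℕ) (l : Rn n) (s : ℝ) (e : Fin n → Bool)
    {x : Rn n} (hx : x ∈ hq n (chd l s e) (s / 2)) :
    gg m (N+1) l s x = gg m N (chd l s e) (s / 2) x := by
  simp only [gg]
  rw [Finset.sum_eq_single e, indicator_of_mem hx]
  · intro e' _ hne
    exact indicator_of_notMem (fun h => Set.disjoint_left.1 (hq_disj l s hne) h hx) _
  · simp

lemma SS_nonneg {n : ℕ} (m : Measure (Rn n)) (d : ℝ) (N : ℕ) :
    ∀ l s, 0 < s → 0 ≤ SS m d N l s := by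
  induction N with
  | zero =>
    intro l s hs; rw [SS]; have := av_nonneg m l hs; positivity
  | succ N ih =>
    intro l s hs; rw [SS]; exact Finset.sum_nonneg (fun e _ => ih _ _ (by positivity))

lemma gg_int {n : ℕ} (m : Measure (Rn n)) {d : ℝ} (hd : 0 ≤ d) (N : ℕ) :
    ∀ l s, 0 < s → ∫⁻ x in hq n l s, gg m N l s x ^ (1 + d) = ENNReal.ofReal (SS m d N l s) := by
  induction N with
  | zero =>
    intro l s hs
    have ha := av_nonneg m l hs
    simp only [gg, SS]
    rw [setLIntegral_const, hq_vol l hs, ENNReal.ofReal_rpow_of_nonneg ha (by positivity),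
      ← ENNReal.ofReal_mul (by positivity), Real.rpow_add_of_nonneg ha (by norm_num) hd,
      Real.rpow_one]
    congr 1
    have : av m l s * s ^ n = m.real (hq n l s) := by unfold av; field_simp
    rw [← this]; ring
  | succ N ih =>
    intro l s hs
    rw [SS, ENNReal.ofReal_sum_of_nonneg (fun e _ => SS_nonneg m d N _ _ (by positivity))]
    conv_lhs => rw [hq_split l hs]
    rw [lintegral_iUnion (fun e => hq_meas _ _) (hq_disj l s), tsum_fintype]
    refine Finset.sum_congr rfl (fun e _ => ?_)
    rw [← ih _ _ (by positivity)]
    refine setLIntegral_congr_fun (hq_meas _ _) (fun x hx => ?_)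
    simp only [gg_child m N l s e hx]

lemma gg_pt {n : ℕ} (m : Measure (Rn n)) (N : ℕ) :
    ∀ l s, 0 < s → ∀ x ∈ hq n l s, ∃ l', x ∈ hq n l' (s / 2 ^ N) ∧
      gg m N l s x = ENNReal.ofReal (av m l' (s / 2 ^ N)) := by
  induction N with
  | zero => intro l s hs x hx; exact ⟨l, by simpa using hx, by simp [gg]⟩
  | succ N ih =>
    intro l s hs x hx
    rw [hq_split l hs] at hx
    obtain ⟨e, he⟩ := mem_iUnion.1 hx
    obtain ⟨l', h1, h2⟩ := ih _ _ (by positivity) x he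
    have : s / 2 / 2 ^ N = s / 2 ^ (N + 1) := by rw [pow_succ']; field_simp
    rw [this] at h1 h2
    exact ⟨l', h1, by rw [gg_child m N l s e he, h2]⟩

open Filter Topology in
lemma gg_lim {n : ℕ} (σ : Rn n → ℝ≥0∞) (hσ : AEMeasurable σ volume)
    (hfin : ∀ l s, (volume.withDensity σ) (hq n l s) ≠ ∞) (l : Rn n) {s : ℝ} (hs : 0 < s) :
    ∀ᵐ x ∂(volume.restrict (hq n l s)),
      Tendsto (fun N => gg (volume.withDensity σ) N l s x) atTop (𝓝 (σ x)) := by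
  set m := (volume : Measure (Rn n)).withDensity σ with hm
  have hac : m ≪ volume := withDensity_absolutelyContinuous _ _
  have : IsLocallyFiniteMeasure m := by
    refine ⟨fun x => ⟨Metric.closedBall x 1, Metric.closedBall_mem_nhds x one_pos, ?_⟩⟩
    have := (cube_ae x one_pos)
    rw [cube_eq x zero_le_one] at this
    rw [measure_congr (hac.ae_eq this)]
    exact (hfin _ _).lt_top
  have hrn : m.rnDeriv volume =ᵐ[volume] σ := Measure.rnDeriv_withDensity₀ _ hσ
  rw [ae_restrict_iff' (hq_meas _ _)]
  filter_upwards [(IsUnifLocDoublingMeasure.vitaliFamily (volume : Measure (Rn n)) 1).ae_tendsto_rnDeriv m,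
    hrn] with x hx hx' hxQ
  rw [← hx']
  choose L hL hL2 using fun N => gg_pt m N l s hs x hxQ
  have hsN : ∀ N : ℕ, 0 < s / 2 ^ N := fun N => by positivity
  have key : ∀ N, gg m N l s x =
      m (Metric.closedBall (fun i => L N i + s / 2 ^ N / 2) (s / 2 ^ N / 2)) /
      volume (Metric.closedBall (fun i => L N i + s / 2 ^ N / 2) (s / 2 ^ N / 2)) := by
    intro N
    rw [hL2 N, ofReal_av m _ (hsN N) (hfin _ _), measure_congr (hq_ae (L N) (hsN N)),
      measure_congr (hac.ae_eq (hq_ae (L N) (hsN N)))]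
  simp only [key]
  refine hx.comp (IsUnifLocDoublingMeasure.tendsto_closedBall_filterAt _ _ _ ?_ ?_)
  · rw [tendsto_nhdsWithin_iff]
    constructor
    · have : Tendsto (fun N : ℕ => s / 2 * (1 / 2 : ℝ) ^ N) atTop (𝓝 (s / 2 * 0)) :=
        (_root_.tendsto_pow_atTop_nhds_zero_of_lt_one (by norm_num) (by norm_num)).const_mul _
      rw [mul_zero] at this
      refine this.congr (fun N => ?_)
      rw [one_div, inv_pow]; field_simp
    · exact Eventually.of_forall (fun N => by simp only [mem_Ioi]; have := hsN N; positivity)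
  · refine Eventually.of_forall (fun N => ?_)
    rw [one_mul, Metric.mem_closedBall, dist_pi_le_iff (by have := hsN N; positivity)]
    intro i
    have := hL N i (mem_univ _)
    simp only [mem_Ico] at this
    rw [Real.dist_eq, abs_le]
    constructor <;> linarith

open Filter Topology in
lemma RH {n : ℕ} (σ : Rn n → ℝ≥0∞) (hσ : AEMeasurable σ volume)
    (hfin : ∀ l s, (volume.withDensity σ) (hq n l s) ≠ ∞)
    (hpos : ∀ l s, 0 < s → 0 < (volume.withDensity σ).real (hq n l s)) {d η : ℝ}
    (hd : 0 ≤ d) (hη : 0 < η) (hη1 : η ≤ 1)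
    (hdη : (2 : ℝ) ^ ((n + 1) * d) ≤ 1 + η / 2)
    (H : ∀ l s, 0 < s → ∀ E, MeasurableSet E → E ⊆ hq n l s → s ^ n / 2 ≤ volume.real E →
      η * (volume.withDensity σ).real (hq n l s) ≤ (volume.withDensity σ).real E)
    (l : Rn n) {s : ℝ} (hs : 0 < s) :
    (volume (hq n l s))⁻¹ * ∫⁻ x in hq n l s, σ x ^ (1 + d) ≤ ENNReal.ofReal (2 * 2 ^ d) *
      ((volume (hq n l s))⁻¹ * ∫⁻ x in hq n l s, σ x) ^ (1 + d) := by
  set m := (volume : Measure (Rn n)).withDensity σ with hm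
  have h1 : ∫⁻ x in hq n l s, σ x ^ (1 + d) ≤
      ENNReal.ofReal ((2 * 2 ^ d) * av m l s ^ d * m.real (hq n l s)) := by
    calc ∫⁻ x in hq n l s, σ x ^ (1 + d)
        = ∫⁻ x in hq n l s, liminf (fun N => gg m N l s x ^ (1 + d)) atTop := by
          refine lintegral_congr_ae ?_
          filter_upwards [gg_lim σ hσ hfin l hs] with x hx
          exact ((ENNReal.continuous_rpow_const.tendsto _).comp hx).liminf_eq.symm
      _ ≤ liminf (fun N => ∫⁻ x in hq n l s, gg m N l s x ^ (1 + d)) atTop :=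
          lintegral_liminf_le (fun N => (gg_meas m N l s).pow_const _)
      _ ≤ _ := by
          refine liminf_le_of_le (by isBoundedDefault) (fun b hb => ?_)
          obtain ⟨N, hN⟩ := hb.exists
          refine hN.trans ?_
          rw [gg_int m hd N l s hs]
          exact ENNReal.ofReal_le_ofReal (SS_main m hfin hpos hd hη hη1 hdη H N l s hs)
  have ha := av_nonneg m l hs
  have h2 : (volume (hq n l s))⁻¹ * ∫⁻ x in hq n l s, σ x = ENNReal.ofReal (av m l s) := by
    rw [ofReal_av m l hs (hfin _ _), hm, withDensity_apply _ (hq_meas _ _), mul_comm,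
      ENNReal.div_eq_inv_mul, mul_comm]
  rw [h2, ENNReal.ofReal_rpow_of_nonneg ha (by positivity), ← ENNReal.ofReal_mul (by positivity)]
  refine (mul_le_mul_right h1 _).trans ?_
  rw [hq_vol l hs, ← ENNReal.ofReal_inv_of_pos (by positivity), ← ENNReal.ofReal_mul (by positivity)]
  apply ENNReal.ofReal_le_ofReal
  have h3 : m.real (hq n l s) = av m l s * s ^ n := by unfold av; field_simp
  rw [h3, Real.rpow_add_of_nonneg ha (by norm_num) hd, Real.rpow_one]
  apply le_of_eq
  field_simp

lemma holder_aux {n : ℕ} {p : ℝ} (hp : 1 < p) (W : Rn n → ℝ≥0∞) (hW : AEMeasurable W volume)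
    (hWtop : ∀ x, W x ≠ ∞) (hW0 : ∀ᵐ x ∂volume, W x ≠ 0) (E : Set (Rn n)) :
    volume E ^ p ≤ (∫⁻ x in E, W x) * (∫⁻ x in E, W x ^ (-(1 / (p - 1)))) ^ (p - 1) := by
  have hp0 : 0 < p := by linarith
  have hp1 : 0 < p - 1 := by linarith
  have hc : p.HolderConjugate (p / (p - 1)) := by
    rw [Real.holderConjugate_iff]; refine ⟨hp, ?_⟩; field_simp; ring
  have h := ENNReal.lintegral_mul_le_Lp_mul_Lq (volume.restrict E) hc
    (f := fun x => W x ^ (1 / p)) (g := fun x => (W x ^ (-(1 / (p - 1)))) ^ ((p - 1) / p))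
    (hW.restrict.pow_const _) ((hW.restrict.pow_const _).pow_const _)
  have e0 : ∫⁻ x in E, ((fun x => W x ^ (1 / p)) * (fun x => (W x ^ (-(1 / (p - 1)))) ^ ((p - 1) / p))) x
      = volume E := by
    rw [← setLIntegral_one]
    refine lintegral_congr_ae ?_
    filter_upwards [ae_restrict_of_ae hW0] with x hx
    simp only [Pi.mul_apply]
    rw [← ENNReal.rpow_mul, ← ENNReal.rpow_add _ _ hx (hWtop x)]
    have : 1 / p + -(1 / (p - 1)) * ((p - 1) / p) = 0 := by field_simp; ring
    rw [this, ENNReal.rpow_zero]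
  have e1 : ∀ y : ℝ≥0∞, (y ^ (1 / p)) ^ p = y := fun y => by
    rw [← ENNReal.rpow_mul, one_div_mul_cancel hp0.ne', ENNReal.rpow_one]
  have e2 : ∀ y : ℝ≥0∞, (y ^ ((p - 1) / p)) ^ (p / (p - 1)) = y := fun y => by
    rw [← ENNReal.rpow_mul]
    have : (p - 1) / p * (p / (p - 1)) = 1 := by field_simp
    rw [this, ENNReal.rpow_one]
  rw [e0] at h
  simp only [e1, e2] at h
  have h' := ENNReal.rpow_le_rpow h hp0.le
  rw [ENNReal.mul_rpow_of_nonneg _ _ hp0.le, e1, ← ENNReal.rpow_mul] at h'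
  have : 1 / (p / (p - 1)) * p = p - 1 := by field_simp
  rwa [this] at h'

lemma real_aux {p k V WQ SQ SE : ℝ} (hp : 1 < p) (hk : 0 < k) (hV : 0 < V) (hW : 0 ≤ WQ)
    (hSQ : 0 ≤ SQ) (hSE : 0 ≤ SE)
    (h1 : (V / 2) ^ p ≤ WQ * SE ^ (p - 1)) (h2 : WQ * SQ ^ (p - 1) ≤ k * V ^ p) :
    (2 ^ (-(p / (p - 1))) * k ^ (-(1 / (p - 1)))) * SQ ≤ SE := by
  have hp1 : 0 < p - 1 := by linarith
  have hWp : 0 < WQ := by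
    rcases hW.eq_or_lt with h | h
    · rw [← h, zero_mul] at h1
      have : 0 < (V / 2) ^ p := by positivity
      linarith
    · exact h
  have h3 : SQ ^ (p - 1) ≤ (k * 2 ^ p) * SE ^ (p - 1) := by
    rw [Real.div_rpow hV.le (by norm_num), div_le_iff₀ (by positivity)] at h1
    have : WQ * SQ ^ (p - 1) ≤ WQ * ((k * 2 ^ p) * SE ^ (p - 1)) := by
      calc _ ≤ _ := h2
        _ ≤ k * (WQ * SE ^ (p - 1) * 2 ^ p) := by gcongr
        _ = _ := by ring
    exact le_of_mul_le_mul_left this hWp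
  have h4 := Real.rpow_le_rpow (by positivity) h3 (by positivity : 0 ≤ 1 / (p - 1))
  rw [Real.mul_rpow (by positivity) (by positivity), Real.mul_rpow (by positivity) (by positivity),
    ← Real.rpow_mul hSQ, ← Real.rpow_mul hSE, ← Real.rpow_mul (by norm_num),
    mul_one_div_cancel hp1.ne', Real.rpow_one, Real.rpow_one, mul_one_div] at h4
  rw [Real.rpow_neg (by norm_num), Real.rpow_neg hk.le, ← mul_inv, inv_mul_le_iff₀ (by positivity)]
  linarith

lemma main_aux (n : ℕ) (p : ℝ) (hp : 1 < p) (w : Rn n → ℝ)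
    (hw : LocallyIntegrable w volume) (hK : ApConst n p w < ∞)
    (hne : ∃ c r, 0 < r ∧ ∫⁻ y in cube n c r, ENNReal.ofReal (w y) ≠ 0) :
    1 ≤ (ApConst n p w).toReal ∧ ∀ q d : ℝ, 1 < q → q ≤ p → 0 ≤ d → d ≤ 1 →
      (p - 1) / (q - 1) = 1 + d →
      (n + 1) * d ≤ (2 ^ (-(p / (p - 1))) * (ApConst n p w).toReal ^ (-(1 / (p - 1)))) / 2 →
      ApConst n q w ≤ ENNReal.ofReal (4 ^ (p - 1)) * ApConst n p w := by
  have hp1 : 0 < p - 1 := by linarith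
  set k := (ApConst n p w).toReal with hk
  set W : Rn n → ℝ≥0∞ := fun x => ENNReal.ofReal (w x) with hWdef
  set σ : Rn n → ℝ≥0∞ := fun x => W x ^ (-(1 / (p - 1))) with hσdef
  have hWm : AEMeasurable W volume := hw.aestronglyMeasurable.aemeasurable.ennreal_ofReal
  have hσm : AEMeasurable σ volume := hWm.pow_const _
  have hWt : ∀ x, W x ≠ ∞ := fun x => ENNReal.ofReal_ne_top
  have hA : ∀ c r, 0 < r → ((volume (cube n c r))⁻¹ * ∫⁻ y in cube n c r, W y) *
      ((volume (cube n c r))⁻¹ * ∫⁻ y in cube n c r, σ y) ^ (p - 1) ≤ ApConst n p w := by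
    intro c r hr
    exact le_iSup₂_of_le c r (le_iSup_of_le hr le_rfl)
  have hvt : ∀ c r, 0 < r → volume (cube n c r) ≠ ∞ := by
    intro c r hr
    rw [cube_eq c hr.le]; exact measure_closedBall_lt_top.ne
  have hv0 : ∀ c r, 0 < r → volume (cube n c r) ≠ 0 := by
    intro c r hr
    rw [cube_eq c hr.le]; exact (Metric.measure_closedBall_pos _ _ hr).ne'
  have hWfin : ∀ c r, 0 < r → ∫⁻ y in cube n c r, W y ≠ ∞ := by
    intro c r hr
    rw [cube_eq c hr.le]
    exact ((hw.integrableOn_isCompact (isCompact_closedBall c r)).lintegral_lt_top).ne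
  have hσfin : ∀ c r, 0 < r → ∫⁻ y in cube n c r, σ y ≠ ∞ := by
    intro c r hr
    obtain ⟨c0, r0, hr0, h0⟩ := hne
    set R := dist c c0 + r + r0
    have hR : 0 < R := by positivity
    have s1 : cube n c r ⊆ cube n c R := by
      rw [cube_eq c hr.le, cube_eq c hR.le]
      exact Metric.closedBall_subset_closedBall (by simp only [R]; linarith [dist_nonneg (x := c) (y := c0)])
    have s2 : cube n c0 r0 ⊆ cube n c R := by
      rw [cube_eq c0 hr0.le, cube_eq c hR.le]
      refine Metric.closedBall_subset_closedBall' ?_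
      rw [dist_comm]; simp only [R]; linarith
    have hWR : ∫⁻ y in cube n c R, W y ≠ 0 := by
      intro h; apply h0
      exact le_antisymm ((lintegral_mono_set s2).trans h.le) bot_le
    intro htop
    have htop' : ∫⁻ y in cube n c R, σ y = ∞ :=
      top_le_iff.1 (htop ▸ lintegral_mono_set s1)
    have := hA c R hR
    rw [htop', ENNReal.mul_top (ENNReal.inv_ne_zero.2 (hvt c R hR)), ENNReal.top_rpow_of_pos hp1,
      ENNReal.mul_top (mul_ne_zero (ENNReal.inv_ne_zero.2 (hvt c R hR)) hWR)] at this
    exact absurd hK (not_lt.2 this)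
  have hW0 : ∀ᵐ x ∂volume, W x ≠ 0 := by
    have : ∀ N : ℕ, ∀ᵐ x ∂volume, x ∈ cube n 0 (N + 1) → W x ≠ 0 := by
      intro N
      have hc : MeasurableSet (cube n 0 ((N : ℝ) + 1)) := by
        rw [cube_eq _ (by positivity)]; exact Metric.isClosed_closedBall.measurableSet
      have := ae_lt_top' (hσm.restrict) (hσfin 0 (N + 1) (by positivity))
      rw [ae_restrict_iff' hc] at this
      filter_upwards [this] with x hx hxc h0
      have := hx hxc
      simp only [hσdef, h0] at this
      rw [ENNReal.zero_rpow_of_neg (by simp; linarith)] at this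
      exact lt_irrefl _ this
    rw [← ae_all_iff] at this
    filter_upwards [this] with x hx
    obtain ⟨N, hN⟩ := exists_nat_ge (dist x 0)
    refine hx N ?_
    rw [cube_eq _ (by positivity), Metric.mem_closedBall]; linarith
  have hσ0 : ∀ x, σ x ≠ 0 := by
    intro x h
    simp only [hσdef, ENNReal.rpow_eq_zero_iff] at h
    rcases h with h | h
    · have : 0 < 1 / (p - 1) := by positivity
      linarith [h.2]
    · exact hWt x h.1
  -- transfer to half-open cubes
  have tr : ∀ (f : Rn n → ℝ≥0∞) (l : Rn n) (s : ℝ), 0 < s →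
      ∫⁻ y in hq n l s, f y = ∫⁻ y in cube n (fun i => l i + s / 2) (s / 2), f y := by
    intro f l s hs
    rw [cube_eq _ (by positivity)]
    exact setLIntegral_congr (hq_ae l hs)
  have trv : ∀ (l : Rn n) (s : ℝ), 0 < s →
      volume (hq n l s) = volume (cube n (fun i => l i + s / 2) (s / 2)) := by
    intro l s hs
    rw [cube_eq _ (by positivity)]
    exact measure_congr (hq_ae l hs)
  set m := (volume : Measure (Rn n)).withDensity σ with hm
  have hfin : ∀ l s, m (hq n l s) ≠ ∞ := by
    intro l s
    rcases lt_or_ge 0 s with hs | hs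
    · rw [hm, withDensity_apply _ (hq_meas _ _), tr _ _ _ hs]
      exact hσfin _ _ (by positivity)
    · have h1 := tr σ l 1 one_pos
      have : hq n l s ⊆ hq n l 1 := by
        refine Set.pi_mono (fun i _ => Ico_subset_Ico_right (by linarith))
      refine ne_top_of_le_ne_top ?_ (measure_mono this)
      rw [hm, withDensity_apply _ (hq_meas _ _), h1]
      exact hσfin _ _ (by positivity)
  have hpos : ∀ l s, 0 < s → 0 < m.real (hq n l s) := by
    intro l s hs
    refine ENNReal.toReal_pos ?_ (hfin l s)
    rw [hm, withDensity_apply _ (hq_meas _ _)]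
    intro h
    rw [lintegral_eq_zero_iff' hσm.restrict, Filter.EventuallyEq, ae_iff] at h
    have hu : {a | ¬ σ a = (0 : Rn n → ℝ≥0∞) a} = univ := by
      ext a; simp [hσ0 a]
    rw [hu, Measure.restrict_apply_univ, hq_vol l hs] at h
    have : 0 < s ^ n := by positivity
    simp at h; linarith
  -- real form
  have base : ∀ l s, 0 < s → ∀ E, MeasurableSet E → E ⊆ hq n l s →
      volume.real E ^ p ≤ (∫⁻ y in hq n l s, W y).toReal * m.real E ^ (p - 1) := by
    intro l s hs E hE hsub
    have h := holder_aux hp W hWm hWt hW0 E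
    have h' : volume E ^ p ≤ (∫⁻ y in hq n l s, W y) * m E ^ (p - 1) := by
      rw [hm, withDensity_apply _ hE]
      refine h.trans ?_
      gcongr
    have hmE : m E ≠ ∞ := ne_top_of_le_ne_top (hfin l s) (measure_mono hsub)
    have hWf : ∫⁻ y in hq n l s, W y ≠ ∞ := by
      rw [tr _ _ _ hs]; exact hWfin _ _ (by positivity)
    have := ENNReal.toReal_mono (ENNReal.mul_ne_top hWf
      (ENNReal.rpow_ne_top_of_nonneg hp1.le hmE)) h'
    rwa [ENNReal.toReal_mul, ← ENNReal.toReal_rpow, ← ENNReal.toReal_rpow] at this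
  have base2 : ∀ l s, 0 < s →
      (∫⁻ y in hq n l s, W y).toReal * m.real (hq n l s) ^ (p - 1) ≤ k * (s ^ n) ^ p := by
    intro l s hs
    have h := hA (fun i => l i + s / 2) (s / 2) (by positivity)
    rw [← tr _ _ _ hs, ← tr _ _ _ hs, ← trv _ _ hs, ← withDensity_apply σ (hq_meas _ _), ← hm] at h
    have := ENNReal.toReal_mono hK.ne h
    rw [ENNReal.toReal_mul, ENNReal.toReal_mul, ← ENNReal.toReal_rpow, ENNReal.toReal_mul,
      ENNReal.toReal_inv, ← hk] at this
    change (volume.real (hq n l s))⁻¹ * _ * ((volume.real (hq n l s))⁻¹ * m.real (hq n l s)) ^ (p - 1) ≤ k at this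
    rw [hq_volr l hs, Real.mul_rpow (by positivity) (by positivity), Real.inv_rpow (by positivity)] at this
    have hV : 0 < s ^ n := by positivity
    set V := s ^ n
    have e : V ^ p = V * V ^ (p - 1) := by
      rw [← Real.rpow_one_add' hV.le (by linarith)]; congr 1; ring
    rw [e]
    have hV' : 0 < V ^ (p - 1) := by positivity
    calc _ = (V⁻¹ * (∫⁻ y in hq n l s, W y).toReal * ((V ^ (p - 1))⁻¹ * m.real (hq n l s) ^ (p - 1)))
          * (V * V ^ (p - 1)) := by field_simp
      _ ≤ _ := by gcongr
  have hk1 : 1 ≤ k := by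
    have h1 := base 0 1 one_pos _ (hq_meas _ _) subset_rfl
    have h2 := base2 0 1 one_pos
    rw [hq_volr _ one_pos] at h1
    have := h1.trans h2
    simpa using this
  refine ⟨hk1, ?_⟩
  intro q d hq1 hqp hd0 hd1 hqd hdη
  have hkpos : 0 < k := by linarith
  set η := 2 ^ (-(p / (p - 1))) * k ^ (-(1 / (p - 1))) with hη
  have hηpos : 0 < η := by positivity
  have hη1 : η ≤ 1 := by
    have a1 : (2:ℝ) ^ (-(p / (p - 1))) ≤ 1 :=
      Real.rpow_le_one_of_one_le_of_nonpos (by norm_num) (by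
        have : 0 < p / (p - 1) := by positivity
        linarith)
    have a2 : k ^ (-(1 / (p - 1))) ≤ 1 :=
      Real.rpow_le_one_of_one_le_of_nonpos hk1 (by
        have : 0 < 1 / (p - 1) := by positivity
        linarith)
    exact mul_le_one₀ a1 (by positivity) a2
  have h2 : (2 : ℝ) ^ ((n + 1) * d) ≤ 1 + η / 2 := by
    have := rpow_one_add_le_one_add_mul_self (s := 1) (p := (n + 1) * d) (by norm_num) (by positivity)
      (by linarith)
    norm_num at this
    linarith
  have H : ∀ l s, 0 < s → ∀ E, MeasurableSet E → E ⊆ hq n l s → s ^ n / 2 ≤ volume.real E →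
      η * m.real (hq n l s) ≤ m.real E := by
    intro l s hs E hE hsub hvE
    refine real_aux hp hkpos (by positivity : 0 < s ^ n) ENNReal.toReal_nonneg (by positivity)
      (by positivity) (le_trans ?_ (base l s hs E hE hsub)) (base2 l s hs)
    gcongr
  rw [ApConst]
  refine iSup₂_le (fun c r => iSup_le (fun hr => ?_))
  have hq0 : 0 < q - 1 := by linarith
  have R := RH σ hσm hfin hpos hd0 hηpos hη1 h2 H (fun i => c i - r) (by positivity : 0 < 2 * r)
  rw [← setLIntegral_congr (cube_ae c hr), ← setLIntegral_congr (cube_ae c hr),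
    ← measure_congr (cube_ae c hr)] at R
  have e1 : ∀ y, σ y ^ (1 + d) = W y ^ (-(1 / (q - 1))) := by
    intro y
    simp only [hσdef]
    rw [← ENNReal.rpow_mul, ← hqd]
    congr 1; field_simp
  simp only [e1] at R
  have R2 := ENNReal.rpow_le_rpow R hq0.le
  have e2 : (1 + d) * (q - 1) = p - 1 := by rw [← hqd]; field_simp
  rw [ENNReal.mul_rpow_of_nonneg (ENNReal.ofReal _) _ hq0.le, ← ENNReal.rpow_mul, e2,
    ENNReal.ofReal_rpow_of_nonneg (by positivity) hq0.le] at R2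
  have e3 : (2 * 2 ^ d : ℝ) ^ (q - 1) ≤ 4 ^ (p - 1) := by
    have : (2:ℝ) ^ d ≤ 2 := by
      simpa using Real.rpow_le_rpow_of_exponent_le (by norm_num : (1:ℝ) ≤ 2) hd1
    calc (2 * 2 ^ d : ℝ) ^ (q - 1) ≤ 4 ^ (q - 1) := by gcongr; linarith
      _ ≤ 4 ^ (p - 1) := Real.rpow_le_rpow_of_exponent_le (by norm_num) (by linarith)
  calc _ ≤ ((volume (cube n c r))⁻¹ * ∫⁻ y in cube n c r, W y) * (ENNReal.ofReal (4 ^ (p - 1)) *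
      ((volume (cube n c r))⁻¹ * ∫⁻ y in cube n c r, σ y) ^ (p - 1)) := by
        refine mul_le_mul_right (R2.trans ?_) _
        exact mul_le_mul_left (ENNReal.ofReal_le_ofReal e3) _
    _ = ENNReal.ofReal (4 ^ (p - 1)) * (((volume (cube n c r))⁻¹ * ∫⁻ y in cube n c r, W y) *
      ((volume (cube n c r))⁻¹ * ∫⁻ y in cube n c r, σ y) ^ (p - 1)) := by ring
    _ ≤ _ := mul_le_mul_right (hA c r hr) _

/-- Sharp openness of `A_p`: with `ε = c [w]_{A_p}^{1-p'}` for a suitable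
small constant `c > 0`, one has `ε < p-1`, `w ∈ A_{p-ε}` and
`[w]_{A_{p-ε}} ≤ C(n,p)[w]_{A_p}`. -/
theorem stmt12 (n : ℕ) (p : ℝ) (hp : 1 < p) :
    ∃ c C : ℝ, 0 < c ∧ 0 < C ∧
    ∀ w : Rn n → ℝ, (∀ x, 0 ≤ w x) → LocallyIntegrable w volume → ApConst n p w < ∞ →
      c * (ApConst n p w).toReal ^ (1 - p / (p - 1)) < p - 1 ∧
      ApConst n (p - c * (ApConst n p w).toReal ^ (1 - p / (p - 1))) w < ∞ ∧
      ApConst n (p - c * (ApConst n p w).toReal ^ (1 - p / (p - 1))) w ≤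
        ENNReal.ofReal C * ApConst n p w := by
  have hp1 : 0 < p - 1 := by linarith
  have h2 : (0:ℝ) < 2 ^ (-(p / (p - 1))) := by positivity
  have h21 : (2:ℝ) ^ (-(p / (p - 1))) ≤ 1 :=
    Real.rpow_le_one_of_one_le_of_nonpos (by norm_num) (by
      have : 0 < p / (p - 1) := by positivity
      linarith)
  set b : ℝ := 2 ^ (-(p / (p - 1))) with hb
  have hn : (0:ℝ) < n + 1 := by positivity
  refine ⟨(p - 1) * b / (4 * (n + 1)), 4 ^ (p - 1), by positivity, by positivity, ?_⟩
  intro w _ hw hK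
  have hexp : 1 - p / (p - 1) = -(1 / (p - 1)) := by field_simp; ring
  rw [hexp]
  by_cases hne : ∃ c r, 0 < r ∧ ∫⁻ y in cube n c r, ENNReal.ofReal (w y) ≠ 0
  · obtain ⟨hk1, hmain⟩ := main_aux n p hp w hw hK hne
    set k := (ApConst n p w).toReal
    have hk0 : 0 < k := by linarith
    have hx0 : 0 < k ^ (-(1 / (p - 1))) := by positivity
    have hx1 : k ^ (-(1 / (p - 1))) ≤ 1 :=
      Real.rpow_le_one_of_one_le_of_nonpos hk1 (by
        have : 0 < 1 / (p - 1) := by positivity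
        linarith)
    set x := k ^ (-(1 / (p - 1)))
    have hbx : b * x ≤ 1 := mul_le_one₀ h21 hx0.le hx1
    have hbx0 : 0 < b * x := by positivity
    obtain ⟨u, hu⟩ : ∃ u, u = b * x / (4 * ((n:ℝ) + 1)) := ⟨_, rfl⟩
    have hε : (p - 1) * b / (4 * (n + 1)) * x = (p - 1) * u := by rw [hu]; ring
    have hu0 : 0 < u := by rw [hu]; positivity
    have hun : ((n:ℝ) + 1) * u = b * x / 4 := by rw [hu]; field_simp
    have hu4 : u ≤ 1 / 4 := by nlinarith [(Nat.cast_nonneg n : (0:ℝ) ≤ n)]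
    rw [hε]
    have hq : p - (p - 1) * u - 1 = (p - 1) * (1 - u) := by ring
    have h1u : 0 < 1 - u := by linarith
    have hdle : u / (1 - u) ≤ 2 * u := by
      rw [div_le_iff₀ h1u]; nlinarith
    have hfinal := hmain (p - (p - 1) * u) (u / (1 - u)) (by nlinarith) (by nlinarith)
      (by positivity) (by linarith) (by rw [hq]; field_simp; ring)
      (by
        calc ((n:ℝ) + 1) * (u / (1 - u)) ≤ (n + 1) * (2 * u) := by gcongr
          _ = b * x / 2 := by rw [mul_left_comm, hun]; ring)
    refine ⟨by nlinarith, lt_of_le_of_lt hfinal ?_, hfinal⟩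
    exact ENNReal.mul_lt_top ENNReal.ofReal_lt_top hK
  · push Not at hne
    have h0 : ∀ q, ApConst n q w = 0 := by
      intro q
      rw [ApConst]
      refine le_antisymm (iSup₂_le (fun c r => iSup_le (fun hr => ?_))) bot_le
      rw [hne c r hr]; simp
    have hz : (-(1 / (p - 1)) : ℝ) ≠ 0 := by
      have : 0 < 1 / (p - 1) := by positivity
      linarith
    simp only [h0, ENNReal.toReal_zero, Real.zero_rpow hz]
    simp; linarith
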